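/- arXiv:1407.6477 — 3 statements merged into one kernel-verified Lean document; each statement's English description precedes it below -/
import Mathlib

section
/- Let n, L ≥ 1 and let A₁, …, A_L be n×n real matrices. Suppose there exists a symmetric positive definite n×n real matrix P such that AᵢᵀP + PAᵢ is negative definite for every i ∈ {1, …, L}. Let x : ℝ → ℝⁿ be a function such that for every t ≥ 0 there exists i ∈ {1, …, L} with x differentiable at t with derivative Aᵢ · x(t) (matrix–vector product). Then x(t) → 0 as t → ∞. -/
open Matrix Filter

/-- A quadratic form is bounded below by a multiple of the squared norm. -/
lemma quad_lower {n : ℕ} (M : Matrix (Fin n) (Fin n) ℝ) :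
    ∃ m : ℝ, (M.PosDef → 0 < m) ∧ ∀ v : Fin n → ℝ, m * ‖v‖ ^ 2 ≤ v ⬝ᵥ (M *ᵥ v) := by
  by_cases hne : (Metric.sphere (0 : Fin n → ℝ) 1).Nonempty
  · have hcont : Continuous (fun v : Fin n → ℝ => v ⬝ᵥ (M *ᵥ v)) := by fun_prop
    obtain ⟨w, hw, hmin⟩ := (isCompact_sphere (0 : Fin n → ℝ) 1).exists_isMinOn hne
      hcont.continuousOn
    refine ⟨w ⬝ᵥ (M *ᵥ w), ?_, ?_⟩
    · intro hM
      have hw0 : w ≠ 0 := by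
        rintro rfl
        simp at hw
      simpa using hM.dotProduct_mulVec_pos hw0
    · intro v
      by_cases hv : v = 0
      · simp [hv]
      have hv' : ‖v‖ ≠ 0 := norm_ne_zero_iff.mpr hv
      have hs : ‖v‖⁻¹ • v ∈ Metric.sphere (0 : Fin n → ℝ) 1 := by
        simp [norm_smul, hv']
      have h := hmin hs
      simp only [Set.mem_ofPred_eq, mulVec_smul, smul_dotProduct, dotProduct_smul, smul_eq_mul] at h
      calc w ⬝ᵥ (M *ᵥ w) * ‖v‖ ^ 2
          ≤ (‖v‖⁻¹ * (‖v‖⁻¹ * (v ⬝ᵥ (M *ᵥ v)))) * ‖v‖ ^ 2 := by gcongr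
        _ = v ⬝ᵥ (M *ᵥ v) := by field_simp
  · refine ⟨1, fun _ => one_pos, fun v => ?_⟩
    have hv : v = 0 := by
      by_contra hv
      have hv' : ‖v‖ ≠ 0 := norm_ne_zero_iff.mpr hv
      exact hne ⟨‖v‖⁻¹ • v, by simp [norm_smul, hv']⟩
    simp [hv]

lemma quad_deriv {n : ℕ} (P : Matrix (Fin n) (Fin n) ℝ) (x : ℝ → Fin n → ℝ) (y : Fin n → ℝ)
    (t : ℝ) (h : HasDerivAt x y t) :
    HasDerivAt (fun s => x s ⬝ᵥ (P *ᵥ x s)) (y ⬝ᵥ (P *ᵥ x t) + x t ⬝ᵥ (P *ᵥ y)) t := by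
  have hc := hasDerivAt_pi.mp h
  have h2 : ∀ i, HasDerivAt (fun s => (P *ᵥ x s) i) ((P *ᵥ y) i) t := fun i => by
    simp only [mulVec, dotProduct]
    exact HasDerivAt.fun_sum fun j _ => (hc j).const_mul (P i j)
  have := HasDerivAt.fun_sum (u := Finset.univ) fun i _ => (hc i).fun_mul (h2 i)
  simpa only [dotProduct, ← Finset.sum_add_distrib] using this

theorem stmt_4 (n L : ℕ) (hn : 1 ≤ n) (hL : 1 ≤ L)
    (A : Fin L → Matrix (Fin n) (Fin n) ℝ)
    (P : Matrix (Fin n) (Fin n) ℝ) (hPsym : Pᵀ = P) (hP : P.PosDef)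
    (hLyap : ∀ i : Fin L, (-((A i)ᵀ * P + P * A i)).PosDef)
    (x : ℝ → (Fin n → ℝ))
    (hx : ∀ t : ℝ, 0 ≤ t → ∃ i : Fin L, HasDerivAt x ((A i).mulVec (x t)) t) :
    Filter.Tendsto x Filter.atTop (nhds 0) := by
  obtain ⟨m, hm, hmP⟩ := quad_lower P
  replace hm := hm hP
  obtain ⟨C', -, hC'⟩ := quad_lower (-P)
  obtain ⟨C, hC0, hC⟩ : ∃ C : ℝ, 0 < C ∧ ∀ v : Fin n → ℝ, v ⬝ᵥ (P *ᵥ v) ≤ C * ‖v‖ ^ 2 := by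
    refine ⟨|C'| + 1, by positivity, fun v => ?_⟩
    have h := hC' v
    rw [neg_mulVec, dotProduct_neg] at h
    nlinarith [neg_abs_le C', sq_nonneg ‖v‖]
  choose c hc hcA using fun i => quad_lower (-((A i)ᵀ * P + P * A i))
  obtain ⟨d, hd, hdc⟩ : ∃ d : ℝ, 0 < d ∧ ∀ i, d ≤ c i := by
    haveI : Nonempty (Fin L) := ⟨⟨0, hL⟩⟩
    obtain ⟨i, hi⟩ := Finite.exists_min c
    exact ⟨c i, hc i (hLyap i), hi⟩
  set V : ℝ → ℝ := fun s => x s ⬝ᵥ (P *ᵥ x s) with hV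
  set k := d / C with hk
  have hk0 : 0 < k := by positivity
  have hVd : ∀ t, 0 ≤ t → ∃ V', HasDerivAt V V' t ∧ V' ≤ -k * V t := by
    intro t ht
    obtain ⟨i, hi⟩ := hx t ht
    refine ⟨_, quad_deriv P x _ t hi, ?_⟩
    have h1 := hcA i (x t)
    have e : x t ⬝ᵥ (-((A i)ᵀ * P + P * A i) *ᵥ x t) =
        -((A i *ᵥ x t) ⬝ᵥ (P *ᵥ x t) + x t ⬝ᵥ (P *ᵥ (A i *ᵥ x t))) := by
      rw [neg_mulVec, dotProduct_neg, add_mulVec, dotProduct_add, ← mulVec_mulVec,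
        ← mulVec_mulVec, dotProduct_mulVec (x t) (A i)ᵀ, vecMul_transpose]
    rw [e] at h1
    have h2 : d * ‖x t‖ ^ 2 ≤ c i * ‖x t‖ ^ 2 := by gcongr; exact hdc i
    have h3 : k * V t ≤ k * (C * ‖x t‖ ^ 2) := by gcongr; exact hC _
    have h4 : k * (C * ‖x t‖ ^ 2) = d * ‖x t‖ ^ 2 := by rw [hk]; field_simp
    linarith
  have hW : ∀ t, 0 ≤ t → ∃ W', HasDerivAt (fun s => Real.exp (k * s) * V s) W' t ∧ W' ≤ 0 := by
    intro t ht
    obtain ⟨V', h1, h2⟩ := hVd t ht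
    have h3 : HasDerivAt (fun s => Real.exp (k * s)) (Real.exp (k * t) * (k * 1)) t :=
      ((hasDerivAt_id t).const_mul k).exp
    refine ⟨_, h3.mul h1, ?_⟩
    nlinarith [Real.exp_pos (k * t)]
  have hanti : AntitoneOn (fun s => Real.exp (k * s) * V s) (Set.Ici 0) := by
    apply antitoneOn_of_deriv_nonpos (convex_Ici 0)
    · intro t ht
      obtain ⟨W', h, -⟩ := hW t ht
      exact h.continuousAt.continuousWithinAt
    · intro t ht
      obtain ⟨W', h, -⟩ := hW t (interior_subset ht)
      exact h.differentiableAt.differentiableWithinAt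
    · intro t ht
      obtain ⟨W', h, h'⟩ := hW t (interior_subset ht)
      rw [h.deriv]; exact h'
  have hb : ∀ t, 0 ≤ t → ‖x t‖ ^ 2 ≤ V 0 / m * Real.exp (-(k * t)) := by
    intro t ht
    have h1 := hanti (Set.mem_Ici.mpr le_rfl) (Set.mem_Ici.mpr ht) ht
    simp only [mul_zero, Real.exp_zero, one_mul] at h1
    have h2 : m * ‖x t‖ ^ 2 ≤ V t := hmP (x t)
    rw [Real.exp_neg, div_mul_eq_mul_div, le_div_iff₀ hm, ← div_eq_mul_inv,
      le_div_iff₀ (Real.exp_pos _)]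
    nlinarith [Real.exp_pos (k * t)]
  have hlim : Tendsto (fun t => V 0 / m * Real.exp (-(k * t))) atTop (nhds 0) := by
    have : Tendsto (fun t => Real.exp (-(k * t))) atTop (nhds 0) :=
      Real.tendsto_exp_neg_atTop_nhds_zero.comp (tendsto_id.const_mul_atTop hk0)
    simpa using this.const_mul (V 0 / m)
  have hsq : Tendsto (fun t => ‖x t‖ ^ 2) atTop (nhds 0) :=
    squeeze_zero' (Eventually.of_forall fun t => by positivity)
      ((eventually_ge_atTop 0).mono hb) hlim
  rw [tendsto_zero_iff_norm_tendsto_zero]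
  have := hsq.sqrt
  simpa [Real.sqrt_sq] using this
end

section
/- For every real β > 0, the following two statements are equivalent: (1) for every ω ∈ ℝ, the complex number ((0.8β − ω²) + 0.2ω·i) / ((1 − 1.2ω²) + (1.2ω − ω³)·i) has strictly positive real part; (2) (0.96β + 0.76)² < 3.2β. Moreover, the denominator (1 − 1.2ω²) + (1.2ω − ω³)·i is nonzero for every ω ∈ ℝ. -/
open Complex

theorem aux_re (a b c d : ℝ) (h : 0 < c ^ 2 + d ^ 2) :
    0 < (((a : ℂ) + (b : ℂ) * Complex.I) / ((c : ℂ) + (d : ℂ) * Complex.I)).re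
      ↔ 0 < a * c + b * d := by
  have e : (((a : ℂ) + (b : ℂ) * Complex.I) / ((c : ℂ) + (d : ℂ) * Complex.I)).re
      = (a * c + b * d) / (c ^ 2 + d ^ 2) := by
    rw [Complex.div_re]
    simp [Complex.normSq_apply]
    rw [← add_div, pow_two, pow_two]
  rw [e, div_pos_iff_of_pos_right h]

theorem aux_den (ω : ℝ) : 0 < (1 - 1.2 * ω ^ 2) ^ 2 + (1.2 * ω - ω ^ 3) ^ 2 := by
  by_contra hn
  have h1 : 1 - 1.2 * ω ^ 2 = 0 := by
    nlinarith [sq_nonneg (1 - 1.2 * ω ^ 2), sq_nonneg (1.2 * ω - ω ^ 3)]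
  have h2 : 1.2 * ω - ω ^ 3 = 0 := by
    nlinarith [sq_nonneg (1 - 1.2 * ω ^ 2), sq_nonneg (1.2 * ω - ω ^ 3)]
  have h3 : ω ^ 2 = 5 / 6 := by linarith
  have h4 : ω * (1.2 - ω ^ 2) = 0 := by linarith
  rw [h3] at h4
  have h5 : ω = 0 := by linarith
  rw [h5] at h3
  norm_num at h3

theorem stmt_5 (β : ℝ) (hβ : 0 < β) :
    ((∀ ω : ℝ,
        0 < (((0.8 * (β : ℂ) - (ω : ℂ) ^ 2) + 0.2 * (ω : ℂ) * Complex.I) /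
              ((1 - 1.2 * (ω : ℂ) ^ 2) + (1.2 * (ω : ℂ) - (ω : ℂ) ^ 3) * Complex.I)).re)
      ↔ (0.96 * β + 0.76) ^ 2 < 3.2 * β)
    ∧ (∀ ω : ℝ,
        (1 - 1.2 * (ω : ℂ) ^ 2) + (1.2 * (ω : ℂ) - (ω : ℂ) ^ 3) * Complex.I ≠ 0) := by
  have key : ∀ ω : ℝ,
      (0 < (((0.8 * (β : ℂ) - (ω : ℂ) ^ 2) + 0.2 * (ω : ℂ) * Complex.I) /
              ((1 - 1.2 * (ω : ℂ) ^ 2) + (1.2 * (ω : ℂ) - (ω : ℂ) ^ 3) * Complex.I)).re)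
      ↔ 0 < (ω ^ 2) ^ 2 - (0.96 * β + 0.76) * ω ^ 2 + 0.8 * β := by
    intro ω
    have h := aux_re (0.8 * β - ω ^ 2) (0.2 * ω) (1 - 1.2 * ω ^ 2) (1.2 * ω - ω ^ 3) (aux_den ω)
    have e : (0.8 * β - ω ^ 2) * (1 - 1.2 * ω ^ 2) + (0.2 * ω) * (1.2 * ω - ω ^ 3)
        = (ω ^ 2) ^ 2 - (0.96 * β + 0.76) * ω ^ 2 + 0.8 * β := by ring
    rw [e] at h
    rw [← h]
    push_cast
    rfl
  refine ⟨⟨fun H => ?_, fun H ω => ?_⟩, fun ω h => ?_⟩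
  · have h := (key (Real.sqrt ((0.96 * β + 0.76) / 2))).1 (H _)
    rw [Real.sq_sqrt (by positivity)] at h
    nlinarith
  · rw [key]
    nlinarith [sq_nonneg (ω ^ 2 - (0.96 * β + 0.76) / 2)]
  · have hd := aux_den ω
    have e : (1 - 1.2 * (ω : ℂ) ^ 2) + (1.2 * (ω : ℂ) - (ω : ℂ) ^ 3) * Complex.I
        = ((1 - 1.2 * ω ^ 2 : ℝ) : ℂ) + ((1.2 * ω - ω ^ 3 : ℝ) : ℂ) * Complex.I := by
      push_cast
      rfl
    rw [e] at h
    have h1 : 1 - 1.2 * ω ^ 2 = 0 := by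
      have := congrArg Complex.re h
      rwa [Complex.add_re, Complex.re_ofReal_mul, Complex.I_re, mul_zero, add_zero, Complex.ofReal_re, Complex.zero_re] at this
    have h2 : 1.2 * ω - ω ^ 3 = 0 := by
      have := congrArg Complex.im h
      rwa [Complex.add_im, Complex.im_ofReal_mul, Complex.I_im, mul_one, Complex.ofReal_im, zero_add, Complex.zero_im] at this
    rw [h1, h2] at hd
    norm_num at hd
end

section
/- For every real β, there exists ω ∈ ℝ such that the complex number ((0.8β − ω²) + 0.2ω·i) / ((1 − 0.2ω²) + (ω − ω³)·i) has strictly negative real part. Moreover, the denominator (1 − 0.2ω²) + (ω − ω³)·i is nonzero for every ω ∈ ℝ. -/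
open Complex

theorem stmt_6 (β : ℝ) :
    (∃ ω : ℝ,
        (((0.8 * (β : ℂ) - (ω : ℂ) ^ 2) + 0.2 * (ω : ℂ) * Complex.I) /
            ((1 - 0.2 * (ω : ℂ) ^ 2) + ((ω : ℂ) - (ω : ℂ) ^ 3) * Complex.I)).re < 0)
    ∧ (∀ ω : ℝ,
        (1 - 0.2 * (ω : ℂ) ^ 2) + ((ω : ℂ) - (ω : ℂ) ^ 3) * Complex.I ≠ 0) := by
  have hden : ∀ ω : ℝ, (1 - 0.2 * (ω : ℂ) ^ 2) + ((ω : ℂ) - (ω : ℂ) ^ 3) * Complex.I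
      = (⟨1 - 0.2 * ω ^ 2, ω - ω ^ 3⟩ : ℂ) := by
    intro ω
    rw [Complex.mk_eq_add_mul_I]
    push_cast
    norm_num
  have hnum : ∀ ω : ℝ, (0.8 * (β : ℂ) - (ω : ℂ) ^ 2) + 0.2 * (ω : ℂ) * Complex.I
      = (⟨0.8 * β - ω ^ 2, 0.2 * ω⟩ : ℂ) := by
    intro ω
    rw [Complex.mk_eq_add_mul_I]
    push_cast
    norm_num
  constructor
  · refine ⟨√5, ?_⟩
    have h5 : (√5 : ℝ) ^ 2 = 5 := Real.sq_sqrt (by norm_num)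
    have h3 : (√5 : ℝ) ^ 3 = 5 * √5 := by rw [pow_succ, h5]
    rw [hden, hnum, Complex.div_re, Complex.normSq_mk, h3, h5]
    have e : (1 - 0.2 * 5 : ℝ) = 0 := by norm_num
    have e2 : (√5 - 5 * √5) * (√5 - 5 * √5) = (80 : ℝ) := by nlinarith
    have e3 : 0.2 * √5 * (√5 - 5 * √5) = (-4 : ℝ) := by nlinarith
    simp only [e, e2, e3]
    norm_num
  · intro ω h
    rw [hden] at h
    have h1 := congrArg Complex.re h
    have h2 := congrArg Complex.im h
    simp only [Complex.zero_re, Complex.zero_im] at h1 h2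
    have h5 : ω ^ 2 = 5 := by linarith
    have h3 : ω ^ 3 = 5 * ω := by rw [pow_succ, h5]
    have h0 : ω = 0 := by linarith
    rw [h0] at h5
    norm_num at h5
end
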